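/- For every alternating sign matrix A of size n, β(A) equals the number of bigrassmannian permutations v in S_n whose permutation matrix B satisfies B ≤ A in ASM order. -/

import Mathlib

/-- An alternating sign matrix of size `n`, with entries indexed by `1..n`
(entries outside this range are irrelevant). -/
def IsASM (n : ℕ) (A : ℕ → ℕ → ℤ) : Prop :=
  (∀ i ∈ Finset.Icc 1 n, ∀ j ∈ Finset.Icc 1 n, A i j = -1 ∨ A i j = 0 ∨ A i j = 1) ∧
  (∀ i ∈ Finset.Icc 1 n, ∀ j ∈ Finset.Icc 1 n,
      (∑ k ∈ Finset.Icc 1 j, A i k) = 0 ∨ (∑ k ∈ Finset.Icc 1 j, A i k) = 1) ∧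
  (∀ i ∈ Finset.Icc 1 n, ∀ j ∈ Finset.Icc 1 n,
      (∑ k ∈ Finset.Icc 1 i, A k j) = 0 ∨ (∑ k ∈ Finset.Icc 1 i, A k j) = 1) ∧
  (∀ i ∈ Finset.Icc 1 n, (∑ k ∈ Finset.Icc 1 n, A i k) = 1) ∧
  (∀ j ∈ Finset.Icc 1 n, (∑ k ∈ Finset.Icc 1 n, A k j) = 1)

/-- Corner sum matrix: `Ã(i,j) = Σ_{p ≤ i, q ≤ j} a_{pq}` (zero when `i = 0` or `j = 0`). -/
def cornerSum (A : ℕ → ℕ → ℤ) (i j : ℕ) : ℤ :=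
  ∑ p ∈ Finset.Icc 1 i, ∑ q ∈ Finset.Icc 1 j, A p q

/-- `R_{ij}^{kl}` (for `1 ≤ i < j ≤ n`, `1 ≤ k < l ≤ n`) is an essential rectangle for `A`. -/
def EssRect (n : ℕ) (A : ℕ → ℕ → ℤ) (i j k l : ℕ) : Prop :=
  1 ≤ i ∧ i < j ∧ j ≤ n ∧ 1 ≤ k ∧ k < l ∧ l ≤ n ∧
  ∀ p q, i ≤ p → p < j → k ≤ q → q < l →
    cornerSum A p k = cornerSum A p (k - 1) ∧
    cornerSum A p l = cornerSum A p (l - 1) + 1 ∧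
    cornerSum A i q = cornerSum A (i - 1) q ∧
    cornerSum A j q = cornerSum A (j - 1) q + 1

/-- The bigrassmannian statistic `β(A) = Σ min(i,j) − Σ Ã(i,j)`. -/
def asmBeta (n : ℕ) (A : ℕ → ℕ → ℤ) : ℤ :=
  (∑ i ∈ Finset.Icc 1 n, ∑ j ∈ Finset.Icc 1 n, (min i j : ℤ)) -
    ∑ i ∈ Finset.Icc 1 n, ∑ j ∈ Finset.Icc 1 n, cornerSum A i j

/-- ASM (Bruhat) order: `A ≤ B` iff `Ã(i,j) ≥ B̃(i,j)` for all `i, j`. -/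
def ASMLE (n : ℕ) (A B : ℕ → ℕ → ℤ) : Prop :=
  ∀ i ∈ Finset.Icc 1 n, ∀ j ∈ Finset.Icc 1 n, cornerSum B i j ≤ cornerSum A i j

/-- The labelled ASM-graph edge relation `A →_{ij}^{kl} B`. -/
def ASMEdge (n : ℕ) (A B : ℕ → ℕ → ℤ) (i j k l : ℕ) : Prop :=
  EssRect n B i j k l ∧
  (∀ p q, i ≤ p → p < j → k ≤ q → q < l → cornerSum A p q = cornerSum B p q + 1) ∧
  (∀ p q, p ≤ n → q ≤ n → ¬(i ≤ p ∧ p < j ∧ k ≤ q ∧ q < l) →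
      cornerSum A p q = cornerSum B p q)

/-- The ASM-graph edge relation `A → B`. -/
def ASMEdgeRel (n : ℕ) (A B : ℕ → ℕ → ℤ) : Prop :=
  ∃ i j k l, ASMEdge n A B i j k l

/-- The `0/1` permutation matrix of a permutation of `ℕ`. -/
def PermMatrixZ (u : Equiv.Perm ℕ) : ℕ → ℕ → ℤ :=
  fun i j => if u i = j then 1 else 0

/-- A permutation (of `ℕ`, supported on `1..n`) is bigrassmannian: there is a unique pair
`(i,j) ∈ [n-1]²` with `u⁻¹(i) > u⁻¹(i+1)` and `u(j) > u(j+1)`. -/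
def IsBigrass (n : ℕ) (u : Equiv.Perm ℕ) : Prop :=
  ∃! p : ℕ × ℕ, (1 ≤ p.1 ∧ p.1 ≤ n - 1 ∧ 1 ≤ p.2 ∧ p.2 ≤ n - 1) ∧
    u.symm (p.1 + 1) < u.symm p.1 ∧ u (p.2 + 1) < u p.2

/-- The ASM Laurent monomial `x^A` evaluated at a real matrix `M`. -/
noncomputable def asmMon (n : ℕ) (A : ℕ → ℕ → ℤ) (M : ℕ → ℕ → ℝ) : ℝ :=
  ∏ p ∈ Finset.Icc 1 n, ∏ q ∈ Finset.Icc 1 n, M p q ^ A p q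

/-- A real matrix (indexed by `1..n`) is totally nonnegative: every minor is nonnegative. -/
def IsTNNReal (n : ℕ) (M : ℕ → ℕ → ℝ) : Prop :=
  ∀ (r : ℕ) (f g : Fin r → ℕ), StrictMono f → StrictMono g →
    (∀ a, f a ∈ Finset.Icc 1 n) → (∀ a, g a ∈ Finset.Icc 1 n) →
    0 ≤ (Matrix.of (fun a b => M (f a) (g b))).det

open Finset in
theorem cornerSum_succ_left (A : ℕ → ℕ → ℤ) (i j : ℕ) :
    cornerSum A (i + 1) j = cornerSum A i j + ∑ q ∈ Icc 1 j, A (i + 1) q := by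
  simp [cornerSum, Finset.sum_Icc_succ_top]

open Finset in
theorem cornerSum_transpose (A : ℕ → ℕ → ℤ) (i j : ℕ) :
    cornerSum (fun p q => A q p) i j = cornerSum A j i :=
  Finset.sum_comm

@[simp]
theorem cornerSum_zero_left (A : ℕ → ℕ → ℤ) (j : ℕ) : cornerSum A 0 j = 0 := by
  simp [cornerSum]

theorem IsASM.transpose {n : ℕ} {A : ℕ → ℕ → ℤ} (hA : IsASM n A) :
    IsASM n fun p q => A q p :=
  ⟨fun i hi j hj => hA.1 j hj i hi, fun i hi j hj => hA.2.2.1 j hj i hi,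
    fun i hi j hj => hA.2.1 j hj i hi, hA.2.2.2.2, hA.2.2.2.1⟩

theorem IsASM.cornerSum_step {n : ℕ} {A : ℕ → ℕ → ℤ} (hA : IsASM n A) {i j : ℕ}
    (hi : i + 1 ≤ n) (hj : j ≤ n) :
    cornerSum A i j ≤ cornerSum A (i + 1) j ∧ cornerSum A (i + 1) j ≤ cornerSum A i j + 1 := by
  rw [cornerSum_succ_left]
  rcases Nat.eq_zero_or_pos j with rfl | hj0
  · simp
  · have := hA.2.1 (i + 1) (by simp; omega) j (by simp; omega)
    omega

/-- Corner sums of an ASM are monotone and 1-Lipschitz in the row index. -/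
theorem IsASM.cornerSum_add_left {n : ℕ} {A : ℕ → ℕ → ℤ} (hA : IsASM n A) {i j : ℕ} (d : ℕ)
    (hi : i + d ≤ n) (hj : j ≤ n) :
    cornerSum A i j ≤ cornerSum A (i + d) j ∧ cornerSum A (i + d) j ≤ cornerSum A i j + d := by
  induction d with
  | zero => simp
  | succ d ih =>
    have h₁ := ih (by omega)
    have h₂ := hA.cornerSum_step (i := i + d) (j := j) (by omega) hj
    rw [← add_assoc]
    omega

theorem IsASM.cornerSum_add_right {n : ℕ} {A : ℕ → ℕ → ℤ} (hA : IsASM n A) {i j : ℕ} (d : ℕ)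
    (hi : i ≤ n) (hj : j + d ≤ n) :
    cornerSum A i j ≤ cornerSum A i (j + d) ∧ cornerSum A i (j + d) ≤ cornerSum A i j + d := by
  simpa only [cornerSum_transpose] using hA.transpose.cornerSum_add_left d hj hi

theorem IsASM.cornerSum_full_right {n : ℕ} {A : ℕ → ℕ → ℤ} (hA : IsASM n A) {i : ℕ}
    (hi : i ≤ n) : cornerSum A i n = i := by
  rw [cornerSum, Finset.sum_congr rfl fun p hp => hA.2.2.2.1 p ?_]
  · simp
  · simp only [Finset.mem_Icc] at hp ⊢
    omega

theorem IsASM.cornerSum_nonneg {n : ℕ} {A : ℕ → ℕ → ℤ} (hA : IsASM n A) {i j : ℕ}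
    (hi : i ≤ n) (hj : j ≤ n) : 0 ≤ cornerSum A i j := by
  simpa using (hA.cornerSum_add_left (i := 0) i (by omega) hj).1

theorem IsASM.cornerSum_le_left {n : ℕ} {A : ℕ → ℕ → ℤ} (hA : IsASM n A) {i j : ℕ}
    (hi : i ≤ n) (hj : j ≤ n) : cornerSum A i j ≤ i := by
  simpa using (hA.cornerSum_add_left (i := 0) i (by omega) hj).2

theorem IsASM.cornerSum_le_right {n : ℕ} {A : ℕ → ℕ → ℤ} (hA : IsASM n A) {i j : ℕ}
    (hi : i ≤ n) (hj : j ≤ n) : cornerSum A i j ≤ j := by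
  simpa only [cornerSum_transpose] using hA.transpose.cornerSum_le_left hj hi

theorem IsASM.add_le_cornerSum {n : ℕ} {A : ℕ → ℕ → ℤ} (hA : IsASM n A) {i j : ℕ}
    (hi : i ≤ n) (hj : j ≤ n) : (i : ℤ) + j ≤ cornerSum A i j + n := by
  obtain ⟨d, rfl⟩ := Nat.exists_eq_add_of_le hj
  have h₁ := (hA.cornerSum_add_right (i := i) (j := j) d hi le_rfl).2
  have h₂ := hA.cornerSum_full_right hi
  push_cast at *
  omega

theorem IsASM.cornerSum_le_of_corner {n : ℕ} {A : ℕ → ℕ → ℤ} (hA : IsASM n A) {a b i j : ℕ}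
    (ha : a ≤ n) (hb : b ≤ n) (hi : i ≤ n) (hj : j ≤ n) :
    cornerSum A i j ≤ cornerSum A a b + ((i - a : ℕ) : ℤ) + ((j - b : ℕ) : ℤ) := by
  have h₁ : cornerSum A i j ≤ cornerSum A a j + ((i - a : ℕ) : ℤ) := by
    rcases le_total i a with h | h
    · obtain ⟨d, rfl⟩ := Nat.exists_eq_add_of_le h
      have := (hA.cornerSum_add_left d ha hj).1
      omega
    · obtain ⟨d, rfl⟩ := Nat.exists_eq_add_of_le h
      have := (hA.cornerSum_add_left d hi hj).2
      omega
  have h₂ : cornerSum A a j ≤ cornerSum A a b + ((j - b : ℕ) : ℤ) := by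
    rcases le_total j b with h | h
    · obtain ⟨d, rfl⟩ := Nat.exists_eq_add_of_le h
      have := (hA.cornerSum_add_right d ha hb).1
      omega
    · obtain ⟨d, rfl⟩ := Nat.exists_eq_add_of_le h
      have := (hA.cornerSum_add_right d ha hj).2
      omega
  omega

/-- The function fixing the first `r` positions and exchanging the following adjacent blocks,
of lengths `s` and `t`. -/
def blockSwapFun (r s t p : ℕ) : ℕ :=
  if p ≤ r then p else if p ≤ r + s then p + t else if p ≤ r + s + t then p - s else p

theorem blockSwapFun_blockSwapFun (r s t p : ℕ) :
    blockSwapFun r t s (blockSwapFun r s t p) = p := by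
  unfold blockSwapFun
  split_ifs <;> omega

/-- The permutation fixing the first `r` positions and exchanging the following adjacent blocks,
of lengths `s` and `t`. -/
def blockSwap (r s t : ℕ) : Equiv.Perm ℕ where
  toFun := blockSwapFun r s t
  invFun := blockSwapFun r t s
  left_inv := blockSwapFun_blockSwapFun r s t
  right_inv := blockSwapFun_blockSwapFun r t s

theorem blockSwap_apply (r s t p : ℕ) : blockSwap r s t p =
    if p ≤ r then p else if p ≤ r + s then p + t else if p ≤ r + s + t then p - s else p :=
  rfl

theorem blockSwap_symm (r s t : ℕ) : (blockSwap r s t).symm = blockSwap r t s :=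
  rfl

theorem blockSwap_descent_iff {r s t p : ℕ} (hs : 0 < s) (ht : 0 < t) :
    blockSwap r s t (p + 1) < blockSwap r s t p ↔ p = r + s := by
  simp only [blockSwap_apply]
  split_ifs <;> omega

theorem isBigrass_blockSwap {n r s t : ℕ} (hs : 0 < s) (ht : 0 < t) (hn : r + s + t ≤ n) :
    IsBigrass n (blockSwap r s t) := by
  refine ⟨(r + t, r + s), ?_, ?_⟩
  · exact ⟨by dsimp only; omega, (blockSwap_descent_iff ht hs).2 rfl,
      (blockSwap_descent_iff hs ht).2 rfl⟩
  · rintro ⟨x, y⟩ h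
    simp only [blockSwap_symm, blockSwap_descent_iff hs ht, blockSwap_descent_iff ht hs] at h
    simp [h.2]

theorem sum_permMatrixZ (u : Equiv.Perm ℕ) (i j : ℕ) :
    ∑ q ∈ Finset.Icc 1 j, PermMatrixZ u i q = if 1 ≤ u i ∧ u i ≤ j then 1 else 0 := by
  simp [PermMatrixZ, Finset.sum_ite_eq]

theorem cornerSum_blockSwap (r s t i j : ℕ) :
    cornerSum (PermMatrixZ (blockSwap r s t)) i j =
      (min (min i j) (r + (i - (r + s)) + (j - (r + t))) : ℕ) := by
  induction i with
  | zero => simp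
  | succ i ih =>
    rw [cornerSum_succ_left, ih, sum_permMatrixZ, blockSwap_apply]
    split_ifs <;> omega

theorem asmle_blockSwap_iff {n r s t : ℕ} {A : ℕ → ℕ → ℤ} (hA : IsASM n A) (hs : 0 < s)
    (ht : 0 < t) (hsn : r + s ≤ n) (htn : r + t ≤ n) :
    ASMLE n (PermMatrixZ (blockSwap r s t)) A ↔ cornerSum A (r + s) (r + t) ≤ r := by
  constructor
  · intro h
    have := h (r + s) (by simp; omega) (r + t) (by simp; omega)
    rw [cornerSum_blockSwap] at this
    omega
  · intro h i hi j hj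
    simp only [Finset.mem_Icc] at hi hj
    rw [cornerSum_blockSwap]
    have h₁ := hA.cornerSum_le_left hi.2 hj.2
    have h₂ := hA.cornerSum_le_right hi.2 hj.2
    have h₃ := hA.cornerSum_le_of_corner hsn htn hi.2 hj.2
    omega

/-- `u` is strictly increasing on `{0, …, a}` and on `{a + 1, …}`. -/
def AscendsOffAt (u : ℕ → ℕ) (a : ℕ) : Prop :=
  ∀ ⦃x y⦄, x < y → (y ≤ a ∨ a < x) → u x < u y

theorem AscendsOffAt.le_apply {u : ℕ → ℕ} {a p : ℕ} (h : AscendsOffAt u a) (hp : p ≤ a) :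
    p ≤ u p := by
  induction p with
  | zero => simp
  | succ p ih =>
    have := h (Nat.lt_add_one p) (Or.inl hp)
    have := ih (by omega)
    omega

theorem ascendsOffAt_of_succ {u : ℕ → ℕ} {a : ℕ} (h : ∀ p, p ≠ a → u p < u (p + 1)) :
    AscendsOffAt u a := by
  intro x y hxy hor
  obtain ⟨d, rfl⟩ := Nat.exists_eq_add_of_lt hxy
  clear hxy
  induction d with
  | zero => exact h x (by omega)
  | succ d ih => exact (ih (by omega)).trans (h (x + d + 1) (by omega))

theorem perm_step_of_ascends {u : Equiv.Perm ℕ} {a b p : ℕ} (hu : AscendsOffAt u a)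
    (hv : AscendsOffAt u.symm b) (hp : p ≠ a) (hb : b < u p) : u (p + 1) = u p + 1 := by
  have h₁ : u p < u (p + 1) := hu (Nat.lt_add_one p) (by omega)
  by_contra hne
  have h₂ := hv (x := u p) (y := u p + 1) (by omega) (by omega)
  have h₃ := hv (x := u p + 1) (y := u (p + 1)) (by omega) (by omega)
  simp only [Equiv.symm_apply_apply] at h₂ h₃
  omega

theorem perm_apply_of_ascends {u : Equiv.Perm ℕ} {a b r : ℕ} (hu : AscendsOffAt u a)
    (hv : AscendsOffAt u.symm b) (hd : u.symm (b + 1) < u.symm b)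
    (hr : ∀ p ≤ a, u p ≤ b ↔ p ≤ r) (hra : r ≤ a) :
    (∀ p ≤ r, u p = p) ∧ (∀ p, r < p → p ≤ a → u p = p - r + b) ∧ r < a := by
  have hlow : ∀ p ≤ r, u p = p := by
    intro p hp
    have h₁ := hu.le_apply (hp.trans hra)
    have h₂ := hv.le_apply ((hr p (hp.trans hra)).2 hp)
    simp only [Equiv.symm_apply_apply] at h₂
    omega
  have hm : u.symm (b + 1) ≤ a := by
    by_contra! hlt
    have := hu hd (Or.inr hlt)
    simp only [Equiv.apply_symm_apply] at this
    omega
  have hrm : r < u.symm (b + 1) := by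
    by_contra! hle
    have := (hr _ hm).2 hle
    simp at this
  have hfirst : u (r + 1) = b + 1 := by
    have h₁ : ¬ u (r + 1) ≤ b := fun h => by
      have := (hr (r + 1) (by omega)).1 h
      omega
    rcases (Nat.succ_le_of_lt hrm).eq_or_lt with h | h
    · rw [← Nat.succ_eq_add_one, h, Equiv.apply_symm_apply]
    · have := hu h (Or.inl hm)
      simp only [Equiv.apply_symm_apply, Nat.succ_eq_add_one] at this
      omega
  refine ⟨hlow, fun p hp hpa => ?_, by omega⟩
  obtain ⟨d, rfl⟩ := Nat.exists_eq_add_of_lt hp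
  clear hp
  induction d with
  | zero => simp [hfirst]; omega
  | succ d ih =>
    have h := ih (by omega)
    have := perm_step_of_ascends hu hv (p := r + d + 1) (by omega) (by omega)
    rw [show r + (d + 1) + 1 = r + d + 1 + 1 by omega, this]
    omega

theorem eq_blockSwap_of_ascends {u : Equiv.Perm ℕ} {n a b : ℕ} (hfix : ∀ p, n < p → u p = p)
    (hzero : u 0 = 0) (hu : AscendsOffAt u a) (hv : AscendsOffAt u.symm b)
    (hda : u (a + 1) < u a) (hdb : u.symm (b + 1) < u.symm b) :
    ∃ r, r < a ∧ r < b ∧ u = blockSwap r (a - r) (b - r) := by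
  obtain ⟨r, hra, hr⟩ : ∃ r ≤ a, ∀ p ≤ a, u p ≤ b ↔ p ≤ r := by
    refine ⟨Nat.findGreatest (fun p => u p ≤ b) a, Nat.findGreatest_le a, fun p hp => ?_⟩
    refine ⟨fun h => Nat.le_findGreatest hp h, fun h => ?_⟩
    have hs : u (Nat.findGreatest (fun p => u p ≤ b) a) ≤ b :=
      Nat.findGreatest_spec (P := fun p => u p ≤ b) (Nat.zero_le a) (by simp [hzero])
    rcases h.eq_or_lt with h | h
    · rwa [h]
    · exact (hu h (Or.inl (Nat.findGreatest_le a))).le.trans hs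
  obtain ⟨hlow, hmid, hra'⟩ := perm_apply_of_ascends hu hv hdb hr hra
  have hrb : r ≤ b := by
    have := (hr r hra).2 le_rfl
    rwa [hlow r le_rfl] at this
  have hr' : ∀ q ≤ b, u.symm q ≤ a ↔ q ≤ r := by
    intro q hq
    constructor
    · intro h
      have h₁ := (hr _ h).1 (by simpa using hq)
      have h₂ := hlow _ h₁
      simp only [Equiv.apply_symm_apply] at h₂
      omega
    · intro h
      rw [(Equiv.symm_apply_eq u).2 (hlow q h).symm]
      omega
  obtain ⟨hlow', hmid', hrb'⟩ :=
    perm_apply_of_ascends (u := u.symm) hv (by simpa using hu) (by simpa using hda) hr' hrb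
  have hmid₂ : ∀ p, a < p → p ≤ a + (b - r) → u p = p - (a - r) := by
    intro p h₁ h₂
    have := hmid' (p - (a - r)) (by omega) (by omega)
    rw [Equiv.symm_apply_eq] at this
    rw [this]
    congr 1
    omega
  have hhigh : ∀ p, a + (b - r) < p → b < u p := by
    intro p hp
    by_contra! h
    rcases le_or_gt (u p) r with hle | hlt
    · have := hlow' _ hle
      simp only [Equiv.symm_apply_apply] at this
      omega
    · have := hmid' _ hlt h
      simp only [Equiv.symm_apply_apply] at this
      omega
  have hshift : ∀ d p, a + (b - r) < p → u (p + d) = u p + d := by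
    intro d p hp
    induction d with
    | zero => rfl
    | succ d ih =>
      rw [← add_assoc, perm_step_of_ascends hu hv (by omega) (hhigh _ (by omega)), ih, add_assoc]
  refine ⟨r, hra', hrb', Equiv.ext fun p => ?_⟩
  rw [blockSwap_apply]
  split_ifs with h₁ h₂ h₃
  · exact hlow p h₁
  · rw [hmid p (by omega) (by omega)]
    omega
  · exact hmid₂ p (by omega) (by omega)
  · have h₄ := hshift (n + 1) p (by omega)
    rw [hfix _ (by omega)] at h₄
    omega

theorem ascendsOffAt_of_unique_descent {n a : ℕ} {u : Equiv.Perm ℕ}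
    (hfix : ∀ m, m ∉ Finset.Icc 1 n → u m = m)
    (h : ∀ p, 1 ≤ p → p ≤ n - 1 → u (p + 1) < u p → p = a) : AscendsOffAt u a := by
  refine ascendsOffAt_of_succ fun p hp => ?_
  have hne : u p ≠ u (p + 1) := fun h => by
    have := u.injective h
    omega
  have hzero : u 0 = 0 := hfix 0 (by simp)
  have hfix' : ∀ m, n < m → u m = m := fun m hm => hfix m (by simp; omega)
  rcases Nat.eq_zero_or_pos p with rfl | hp0
  · omega
  rcases le_or_gt p (n - 1) with hpn | hpn
  · by_contra hlt
    exact hp (h p hp0 hpn (by omega))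
  · have hs := hfix' (p + 1) (by omega)
    by_contra hlt
    have hlarge : p + 1 < u p := by omega
    have := u.injective (hfix' (u p) (by omega))
    omega

theorem IsBigrass.exists_eq_blockSwap {n : ℕ} {u : Equiv.Perm ℕ}
    (hfix : ∀ m, m ∉ Finset.Icc 1 n → u m = m) (h : IsBigrass n u) :
    ∃ a b r, a ≤ n ∧ b ≤ n ∧ r < a ∧ r < b ∧ u = blockSwap r (a - r) (b - r) := by
  obtain ⟨⟨b, a⟩, ⟨⟨hb₁, hb₂, ha₁, ha₂⟩, hdb, hda⟩, huniq⟩ := h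
  dsimp only at *
  have hu : AscendsOffAt u a := ascendsOffAt_of_unique_descent hfix fun p h₁ h₂ h₃ =>
    congrArg Prod.snd (huniq (b, p) ⟨⟨hb₁, hb₂, h₁, h₂⟩, hdb, h₃⟩)
  have hv : AscendsOffAt u.symm b := ascendsOffAt_of_unique_descent
    (fun m hm => (Equiv.symm_apply_eq u).2 (hfix m hm).symm) fun p h₁ h₂ h₃ =>
    congrArg Prod.fst (huniq (p, a) ⟨⟨h₁, h₂, ha₁, ha₂⟩, h₃, hda⟩)
  obtain ⟨r, hra, hrb, hr⟩ := eq_blockSwap_of_ascends (n := n)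
    (fun p hp => hfix p (by simp; omega)) (hfix 0 (by simp)) hu hv hda hdb
  exact ⟨a, b, r, by omega, by omega, hra, hrb, hr⟩

theorem blockSwap_injective {r s t r' s' t' : ℕ} (hs : 0 < s) (ht : 0 < t) (hs' : 0 < s')
    (ht' : 0 < t') (h : blockSwap r s t = blockSwap r' s' t') : r = r' ∧ s = s' ∧ t = t' := by
  have h₁ : r + s = r' + s' := by
    rw [← blockSwap_descent_iff hs' ht', ← h, blockSwap_descent_iff hs ht]
  have h₂ : r + t = r' + t' := by
    rw [← blockSwap_descent_iff ht' hs', ← blockSwap_symm, ← h, blockSwap_symm,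
      blockSwap_descent_iff ht hs]
  have h₃ := cornerSum_blockSwap r s t (r + s) (r + t)
  rw [h, cornerSum_blockSwap] at h₃
  omega

/-- The triples `((a, b), r)` with `Ã(a,b) ≤ r < min a b`. -/
def cornerTriples (n : ℕ) (A : ℕ → ℕ → ℤ) : Finset (Σ _ : ℕ × ℕ, ℕ) :=
  (Finset.Icc 1 n ×ˢ Finset.Icc 1 n).sigma fun x =>
    Finset.Ico (cornerSum A x.1 x.2).toNat (min x.1 x.2)

theorem IsASM.asmBeta_eq_card {n : ℕ} {A : ℕ → ℕ → ℤ} (hA : IsASM n A) :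
    asmBeta n A = (cornerTriples n A).card := by
  rw [asmBeta, cornerTriples, Finset.card_sigma, Finset.sum_product, ← Finset.sum_sub_distrib]
  push_cast
  refine Finset.sum_congr rfl fun i hi => ?_
  rw [← Finset.sum_sub_distrib]
  refine Finset.sum_congr rfl fun j hj => ?_
  simp only [Finset.mem_Icc] at hi hj
  have h₁ := hA.cornerSum_le_left hi.2 hj.2
  have h₂ := hA.cornerSum_le_right hi.2 hj.2
  have h₃ := hA.cornerSum_nonneg hi.2 hj.2
  rw [Nat.card_Ico]
  omega

/-- `β(A)` equals the number of bigrassmannian permutations `v ∈ S_n` whose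
permutation matrix lies below `A` in ASM order. -/
theorem beta_eq_card_bigrass_below (n : ℕ) (A : ℕ → ℕ → ℤ) (hA : IsASM n A) :
    asmBeta n A =
      (Set.ncard {u : Equiv.Perm ℕ | (∀ m, m ∉ Finset.Icc 1 n → u m = m) ∧
        IsBigrass n u ∧ ASMLE n (PermMatrixZ u) A} : ℤ) := by
  have himage : {u : Equiv.Perm ℕ | (∀ m, m ∉ Finset.Icc 1 n → u m = m) ∧
      IsBigrass n u ∧ ASMLE n (PermMatrixZ u) A} =
      Set.image (fun x : Σ _ : ℕ × ℕ, ℕ => blockSwap x.2 (x.1.1 - x.2) (x.1.2 - x.2))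
        (cornerTriples n A : Set (Σ _ : ℕ × ℕ, ℕ)) := by
    ext u
    simp only [Set.mem_ofPred_eq, Set.mem_image, Finset.mem_coe, cornerTriples, Finset.mem_sigma,
      Finset.mem_product, Finset.mem_Icc, Finset.mem_Ico, lt_min_iff, Int.toNat_le]
    constructor
    · rintro ⟨hfix, hbig, hle⟩
      obtain ⟨a, b, r, ha, hb, hra, hrb, rfl⟩ :=
        hbig.exists_eq_blockSwap fun m hm => hfix m (by simpa using hm)
      rw [asmle_blockSwap_iff hA (by omega) (by omega) (by omega) (by omega),
        Nat.add_sub_cancel' hra.le, Nat.add_sub_cancel' hrb.le] at hle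
      exact ⟨⟨(a, b), r⟩, ⟨⟨⟨Nat.one_le_of_lt hra, ha⟩, Nat.one_le_of_lt hrb, hb⟩, hle, hra, hrb⟩, rfl⟩
    · rintro ⟨⟨⟨a, b⟩, r⟩, ⟨⟨ha, hb⟩, hle, hra, hrb⟩, rfl⟩
      dsimp only at *
      have hab := hA.add_le_cornerSum ha.2 hb.2
      refine ⟨fun m hm => ?_, isBigrass_blockSwap (Nat.sub_pos_of_lt hra)
        (Nat.sub_pos_of_lt hrb) (by omega), ?_⟩
      · rw [blockSwap_apply]
        split_ifs <;> omega
      · rwa [asmle_blockSwap_iff hA (by omega) (by omega) (by omega) (by omega),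
          Nat.add_sub_cancel' hra.le, Nat.add_sub_cancel' hrb.le]
  rw [himage, Set.InjOn.ncard_image, Set.ncard_coe_finset, hA.asmBeta_eq_card]
  rintro ⟨⟨a, b⟩, r⟩ hx ⟨⟨a', b'⟩, r'⟩ hx' h
  simp only [Finset.mem_coe, cornerTriples, Finset.mem_sigma, Finset.mem_Ico, lt_min_iff] at hx hx'
  obtain ⟨h₁, h₂, h₃⟩ :=
    blockSwap_injective (Nat.sub_pos_of_lt hx.2.2.1) (Nat.sub_pos_of_lt hx.2.2.2)
      (Nat.sub_pos_of_lt hx'.2.2.1) (Nat.sub_pos_of_lt hx'.2.2.2) h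
  dsimp only at h₁ h₂ h₃
  obtain rfl : a = a' := by omega
  obtain rfl : b = b' := by omega
  rw [h₁]
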